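/- Let B₀ > 0 and let k ≥ 1 be an integer. Define ψ_k(r) = √(B₀/Γ(k+1))·(B₀/2)^{k/2}·r^k·exp(−B₀r²/4) for r > 0, where Γ is the Gamma function. Then ∫₀^∞ ψ_k(r)²·(B₀ − 2k/r²)₊·r dr = e^{−k}·k^k·B₀/Γ(k+1), and this quantity is at most B₀/√(2πk). Here x₊ = max(x,0). -/

import Mathlib

open Real MeasureTheory

/-- Integral computation in the proof of Lemma 7.6 (lem-aux): for the normalized Landau
ground state `ψ_k` in `L²((0,∞), r dr)`,
`∫₀^∞ ψ_k(r)² (B₀ − 2k/r²)₊ r dr = e^{−k} k^k B₀ / Γ(k+1) ≤ B₀/√(2πk)`. -/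
theorem landau_ground_state_integral
    (B₀ : ℝ) (hB₀ : 0 < B₀) (k : ℕ) (hk : 1 ≤ k)
    (ψ : ℝ → ℝ)
    (hψ : ∀ r : ℝ, ψ r = Real.sqrt (B₀ / Real.Gamma ((k : ℝ) + 1))
        * (B₀ / 2) ^ ((k : ℝ) / 2) * r ^ k * Real.exp (-B₀ * r ^ 2 / 4)) :
    (∫ r in Set.Ioi (0 : ℝ), ψ r ^ 2 * max (B₀ - 2 * k / r ^ 2) 0 * r)
        = Real.exp (-(k : ℝ)) * (k : ℝ) ^ k * B₀ / Real.Gamma ((k : ℝ) + 1)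
      ∧ (∫ r in Set.Ioi (0 : ℝ), ψ r ^ 2 * max (B₀ - 2 * k / r ^ 2) 0 * r)
        ≤ B₀ / Real.sqrt (2 * π * k) := by
  have hk0 : (0 : ℝ) < k := by exact_mod_cast hk
  have hG : 0 < Real.Gamma ((k : ℝ) + 1) := Real.Gamma_pos_of_pos (by positivity)
  have hψ2 : ∀ r, ψ r ^ 2 = B₀ / Real.Gamma ((k : ℝ) + 1) *
      ((B₀ / 2 * r ^ 2) ^ k * Real.exp (-(B₀ / 2 * r ^ 2))) := by
    intro r
    have h1 : ((B₀ / 2) ^ ((k : ℝ) / 2)) ^ 2 = (B₀ / 2) ^ k := by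
      rw [← Real.rpow_natCast, ← Real.rpow_mul (by positivity), ← Real.rpow_natCast]
      congr 1
      push_cast
      ring
    have h2 : Real.exp (-B₀ * r ^ 2 / 4) ^ 2 = Real.exp (-(B₀ / 2 * r ^ 2)) := by
      rw [← Real.exp_nat_mul]
      congr 1
      push_cast
      ring
    rw [hψ, mul_pow, mul_pow, mul_pow, h1, h2, Real.sq_sqrt (by positivity), mul_pow]
    ring
  set C := B₀ / Real.Gamma ((k : ℝ) + 1) with hC
  have hCpos : 0 < C := by positivity
  set a := Real.sqrt (2 * k / B₀) with ha
  have ha0 : 0 < a := Real.sqrt_pos.mpr (by positivity)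
  have ha2 : a ^ 2 = 2 * k / B₀ := Real.sq_sqrt (by positivity)
  have hsub : (∫ r in Set.Ioi (0 : ℝ), ψ r ^ 2 * max (B₀ - 2 * k / r ^ 2) 0 * r)
      = ∫ r in Set.Ioi a, ψ r ^ 2 * max (B₀ - 2 * k / r ^ 2) 0 * r := by
    refine setIntegral_eq_of_subset_of_forall_sdiff_eq_zero measurableSet_Ioi
      (Set.Ioi_subset_Ioi ha0.le) ?_
    rintro r ⟨hr0, hra⟩
    have hr0 : 0 < r := hr0
    have hra : r ≤ a := not_lt.mp hra
    have : B₀ - 2 * k / r ^ 2 ≤ 0 := by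
      have h : r ^ 2 ≤ 2 * k / B₀ := by rw [← ha2]; gcongr
      rw [le_div_iff₀ hB₀] at h
      rw [sub_nonpos, le_div_iff₀ (by positivity)]
      linarith
    rw [max_eq_right this]
    simp
  have hpos : ∀ r, a ≤ r → 0 ≤ B₀ - 2 * k / r ^ 2 := by
    intro r hr
    have hr0 : 0 < r := ha0.trans_le hr
    have h : 2 * k / B₀ ≤ r ^ 2 := by rw [← ha2]; gcongr
    rw [div_le_iff₀ hB₀] at h
    rw [sub_nonneg, div_le_iff₀ (by positivity)]
    linarith
  have hderiv : ∀ r ∈ Set.Ici a, HasDerivAt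
      (fun r : ℝ => -C * ((B₀ / 2 * r ^ 2) ^ k * Real.exp (-(B₀ / 2 * r ^ 2))))
      (ψ r ^ 2 * max (B₀ - 2 * k / r ^ 2) 0 * r) r := by
    intro r hr
    have hr0 : 0 < r := ha0.trans_le hr
    have hu : HasDerivAt (fun r : ℝ => B₀ / 2 * r ^ 2) (B₀ * r) r := by
      have := (hasDerivAt_pow 2 r).const_mul (B₀ / 2)
      refine this.congr_deriv ?_
      push_cast
      ring
    have := ((hu.fun_pow k).fun_mul hu.fun_neg.exp).const_mul (-C)
    refine this.congr_deriv ?_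
    rw [max_eq_left (hpos r hr), hψ2]
    clear_value C a
    obtain ⟨m, rfl⟩ : ∃ m, k = m + 1 := ⟨k - 1, by omega⟩
    simp only [Nat.add_sub_cancel, pow_succ (B₀ / 2 * r ^ 2) m]
    field_simp
    ring
  have htend : Filter.Tendsto
      (fun r : ℝ => -C * ((B₀ / 2 * r ^ 2) ^ k * Real.exp (-(B₀ / 2 * r ^ 2))))
      Filter.atTop (nhds 0) := by
    have h1 : Filter.Tendsto (fun r : ℝ => B₀ / 2 * r ^ 2) Filter.atTop Filter.atTop :=
      (Filter.tendsto_pow_atTop two_ne_zero).const_mul_atTop (by positivity)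
    simpa using ((Real.tendsto_pow_mul_exp_neg_atTop_nhds_zero k).comp h1).const_mul (-C)
  have hmain := integral_Ioi_of_hasDerivAt_of_nonneg' hderiv (fun r hr => by
    have hr0 : 0 < r := ha0.trans hr
    positivity) htend
  have hau : B₀ / 2 * a ^ 2 = k := by rw [ha2]; field_simp
  have hval : (∫ r in Set.Ioi (0 : ℝ), ψ r ^ 2 * max (B₀ - 2 * k / r ^ 2) 0 * r)
        = Real.exp (-(k : ℝ)) * (k : ℝ) ^ k * B₀ / Real.Gamma ((k : ℝ) + 1) := by
    rw [hsub, hmain, hau, hC]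
    ring
  refine ⟨hval, ?_⟩
  rw [hval, Real.Gamma_nat_eq_factorial]
  have hs := Stirling.le_factorial_stirling k
  have hf : (0 : ℝ) < k.factorial := by positivity
  have he : ((k : ℝ) / Real.exp 1) ^ k = Real.exp (-(k : ℝ)) * (k : ℝ) ^ k := by
    rw [div_pow, ← Real.exp_nat_mul, Real.exp_neg, mul_one]
    ring
  rw [he] at hs
  rw [div_le_div_iff₀ hf (by positivity)]
  nlinarith
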